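/- Let k be a field of characteristic zero and let k, m ≥ 0 be integers. There is an isomorphism of pairs M_{2k} ⊗ M_{2m} ≅ ⊕_{s=|k−m|}^{k+m} Π^{(k+m−s) mod 2} M_{2s}, i.e. an even linear isomorphism intertwining the odd endomorphism on the tensor product with the direct sum of the string endomorphisms. [Clebsch–Gordan decomposition for the supergroup 𝔾_a^{(1|1)}, even ⊗ even case.] -/

import Mathlib

open scoped TensorProduct

section Defs

variable (k : Type*) [Field k]

def IsEvenMap {V : Type*} [AddCommGroup V] [Module k V]
    (V0 V1 : Submodule k V) (f : V →ₗ[k] V) : Prop :=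
  (∀ v ∈ V0, f v ∈ V0) ∧ (∀ v ∈ V1, f v ∈ V1)

def IsOddMap {V : Type*} [AddCommGroup V] [Module k V]
    (V0 V1 : Submodule k V) (f : V →ₗ[k] V) : Prop :=
  (∀ v ∈ V0, f v ∈ V1) ∧ (∀ v ∈ V1, f v ∈ V0)

/-- The shift endomorphism of the string module `M_n`: sends basis vector `a_j` to `a_{j+1}`,
and `a_n` to `0`.  In coordinates, `(x f) j = f (j-1)` for `j ≥ 1` and `(x f) 0 = 0`. -/
def shiftMap (n : ℕ) : (Fin (n+1) → k) →ₗ[k] (Fin (n+1) → k) where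
  toFun f := fun j =>
    if (j : ℕ) = 0 then 0 else f ⟨(j : ℕ) - 1, Nat.lt_of_le_of_lt (Nat.sub_le _ _) j.isLt⟩
  map_add' f g := by funext j; dsimp only [Pi.add_apply]; split_ifs <;> simp
  map_smul' c f := by funext j; dsimp only [Pi.smul_apply]; split_ifs <;> simp

/-- The even (`r = 0`) resp. odd (`r = 1`) part of the string module `Π^ε M_n`:
coordinates `j` with `(j + ε) % 2 = r`. -/
def stringPart (n ε r : ℕ) : Submodule k (Fin (n+1) → k) :=
  Submodule.pi Set.univ (fun j => if ((j : ℕ) + ε) % 2 = r then (⊤ : Submodule k k) else ⊥)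

/-- Isomorphism of pairs (vector superspace with endomorphism): an even linear isomorphism
intertwining the endomorphisms. -/
def PairIso {V : Type*} [AddCommGroup V] [Module k V]
    (V0 V1 : Submodule k V) (x : V →ₗ[k] V)
    {W : Type*} [AddCommGroup W] [Module k W]
    (W0 W1 : Submodule k W) (y : W →ₗ[k] W) : Prop :=
  ∃ φ : V ≃ₗ[k] W, (∀ v ∈ V0, φ v ∈ W0) ∧ (∀ v ∈ V1, φ v ∈ W1) ∧ ∀ v, φ (x v) = y (φ v)

/-- `V` decomposes as a direct sum of `x`-invariant graded subspaces, each isomorphic as a pair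
to some `Π^ε M_n` with `P n`. -/
def DecomposesIntoStrings {V : Type*} [AddCommGroup V] [Module k V]
    (V0 V1 : Submodule k V) (x : V →ₗ[k] V) (P : ℕ → Prop) : Prop :=
  ∃ (m : ℕ) (U : Fin m → Submodule k V), DirectSum.IsInternal U ∧
    ∀ i : Fin m, (U i = (U i ⊓ V0) ⊔ (U i ⊓ V1)) ∧
      ∃ (hx : ∀ v ∈ U i, x v ∈ U i) (n ε : ℕ), ε ≤ 1 ∧ P n ∧
        PairIso k (V0.comap (U i).subtype) (V1.comap (U i).subtype) (x.restrict hx)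
          (stringPart k n ε 0) (stringPart k n ε 1) (shiftMap k n)

/-- A pair `(V, x)` (odd nilpotent `x`) is neat if it decomposes into strings `Π^ε M_{2s}`. -/
def IsNeat {V : Type*} [AddCommGroup V] [Module k V]
    (V0 V1 : Submodule k V) (x : V →ₗ[k] V) : Prop :=
  DecomposesIntoStrings k V0 V1 x (fun n => Even n)

variable {V W : Type*} [AddCommGroup V] [Module k V] [AddCommGroup W] [Module k W]

/-- The set of pure tensors `v ⊗ w` with `v ∈ A`, `w ∈ B`. -/
def pureTensors (A : Submodule k V) (B : Submodule k W) : Set (V ⊗[k] W) :=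
  {t | ∃ v ∈ A, ∃ w ∈ B, t = v ⊗ₜ[k] w}

/-- The even part `(V₀⊗W₀) ⊕ (V₁⊗W₁)` of the tensor product of two superspaces. -/
def tensorEven (V0 V1 : Submodule k V) (W0 W1 : Submodule k W) : Submodule k (V ⊗[k] W) :=
  Submodule.span k (pureTensors k V0 W0 ∪ pureTensors k V1 W1)

/-- The odd part `(V₀⊗W₁) ⊕ (V₁⊗W₀)` of the tensor product of two superspaces. -/
def tensorOdd (V0 V1 : Submodule k V) (W0 W1 : Submodule k W) : Submodule k (V ⊗[k] W) :=
  Submodule.span k (pureTensors k V0 W1 ∪ pureTensors k V1 W0)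

/-- `z` is the super tensor-product endomorphism induced by `x` and `y`:
`z (v ⊗ w) = x v ⊗ w + (-1)^p v ⊗ y w` for `v` homogeneous of parity `p`. -/
def IsSuperTensorMap (V0 V1 : Submodule k V) (x : V →ₗ[k] V) (y : W →ₗ[k] W)
    (z : V ⊗[k] W →ₗ[k] V ⊗[k] W) : Prop :=
  (∀ v ∈ V0, ∀ w : W, z (v ⊗ₜ[k] w) = (x v) ⊗ₜ[k] w + v ⊗ₜ[k] (y w)) ∧
  (∀ v ∈ V1, ∀ w : W, z (v ⊗ₜ[k] w) = (x v) ⊗ₜ[k] w - v ⊗ₜ[k] (y w))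

/-- Componentwise shift endomorphism on a finite direct sum of string modules. -/
def multiShift {N : ℕ} (n : Fin N → ℕ) :
    ((i : Fin N) → (Fin (n i + 1) → k)) →ₗ[k] ((i : Fin N) → (Fin (n i + 1) → k)) :=
  LinearMap.pi (fun i => (shiftMap k (n i)).comp (LinearMap.proj i))

/-- Even/odd part of a finite direct sum of string modules `⊕ᵢ Π^{ε i} M_{n i}`. -/
def multiPart {N : ℕ} (n ε : Fin N → ℕ) (r : ℕ) :
    Submodule k ((i : Fin N) → (Fin (n i + 1) → k)) :=
  Submodule.pi Set.univ (fun i => stringPart k (n i) (ε i) r)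

end Defs


namespace CG

/-- Basis vector `e_j` of the string module (zero if `j > n`). -/
def e (k : Type*) [Field k] (n j : ℕ) : Fin (n+1) → k := fun i => if (i : ℕ) = j then 1 else 0

/-- Structure constants of the lowering operator. -/
def cc {k : Type*} [Field k] (μ : k) (j : ℕ) : k :=
  if j % 2 = 0 then (j : k) / 2 else ((j : k) - 1) / 2 + μ

/-- Lowering operator on `M_{2s}`. -/
def yMap (k : Type*) [Field k] (s : ℕ) : (Fin (2*s+1) → k) →ₗ[k] (Fin (2*s+1) → k) where
  toFun f := fun j => if h : (j : ℕ) + 1 < 2*s+1 then cc (-(s:k)) (j+1) * f ⟨j+1, h⟩ else 0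
  map_add' f g := by
    funext j; dsimp only [Pi.add_apply]; split_ifs <;> simp [mul_add]
  map_smul' c f := by
    funext j; dsimp only [Pi.smul_apply]; split_ifs <;> simp [mul_left_comm]

/-- Diagonal operator. -/
def dMap (k : Type*) [Field k] (n : ℕ) (g : ℕ → k) : (Fin (n+1) → k) →ₗ[k] (Fin (n+1) → k) where
  toFun f := fun j => g j * f j
  map_add' f g := by funext j; simp [mul_add]
  map_smul' c f := by funext j; simp [mul_left_comm]

section basic
variable {k : Type*} [Field k]

lemma e_zero {n j : ℕ} (h : n < j) : e k n j = 0 := by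
  funext i; have := i.2; simp only [e, Pi.zero_apply]; rw [if_neg]; omega

lemma e_ext {V : Type*} [AddCommGroup V] [Module k V] {n : ℕ} {f g : (Fin (n+1) → k) →ₗ[k] V}
    (h : ∀ j, j ≤ n → f (e k n j) = g (e k n j)) : f = g := by
  apply (Pi.basisFun k (Fin (n+1))).ext
  intro i
  have := h i (by omega)
  have h2 : e k n i = Pi.basisFun k (Fin (n+1)) i := by
    funext j
    simp [e, Pi.single_apply, Fin.ext_iff]
  rwa [h2] at this

lemma shift_e (n j : ℕ) : shiftMap k n (e k n j) = e k n (j+1) := by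
  funext i
  simp only [shiftMap, LinearMap.coe_mk, AddHom.coe_mk, e]
  by_cases h : (i:ℕ) = 0
  · simp [h]
  · rw [if_neg h]
    congr 1
    apply propext; omega

lemma dMap_e (n : ℕ) (g : ℕ → k) (j : ℕ) : dMap k n g (e k n j) = g j • e k n j := by
  funext i
  simp only [dMap, LinearMap.coe_mk, AddHom.coe_mk, e, Pi.smul_apply, smul_eq_mul]
  split_ifs with h <;> simp [h]

lemma cc_zero (μ : k) : cc μ 0 = 0 := by simp [cc]

lemma yMap_e [CharZero k] (s j : ℕ) :
    yMap k s (e k (2*s) j) = cc (-(s:k)) j • e k (2*s) (j-1) := by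
  funext i
  have hi := i.2
  simp only [yMap, LinearMap.coe_mk, AddHom.coe_mk, e, Pi.smul_apply, smul_eq_mul]
  rcases j with _ | j
  · simp [cc_zero]
  · simp only [add_tsub_cancel_right, Nat.add_right_cancel_iff]
    by_cases h : (i:ℕ) = j
    · subst h
      by_cases h2 : (i:ℕ)+1 < 2*s+1
      · simp [h2]
      · have h3 : (i:ℕ) = 2*s := by omega
        simp [h3, cc, Nat.add_mod]
    · simp [h]

lemma cc_add [CharZero k] (μ : k) (j : ℕ) : cc μ (j+1) = μ + j - cc μ j := by
  unfold cc
  rcases Nat.mod_two_eq_zero_or_one j with h | h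
  · rw [if_neg (by omega), if_pos h]; push_cast; ring
  · rw [if_pos (by omega), if_neg (by omega)]; push_cast; ring

lemma cc_ne_pos [CharZero k] (m j : ℕ) (h : 0 < j) : cc ((m:k)+1) j ≠ 0 := by
  unfold cc
  split_ifs with h2
  · have : (j:k) ≠ 0 := by exact_mod_cast h.ne'
    simp [this]
  · obtain ⟨i, rfl⟩ : ∃ i, j = 2*i+1 := ⟨j/2, by omega⟩
    have : ((i + m + 1 : ℕ) : k) ≠ 0 := Nat.cast_ne_zero.2 (by omega)
    intro h3; apply this; rw [← h3]; push_cast; ring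

lemma cc_ne_neg [CharZero k] (s j : ℕ) (h : 0 < j) (h' : j ≤ 2*s) : cc (-(s:k)) j ≠ 0 := by
  unfold cc
  split_ifs with h2
  · have : (j:k) ≠ 0 := by exact_mod_cast h.ne'
    simp [this]
  · obtain ⟨i, rfl⟩ : ∃ i, j = 2*i+1 := ⟨j/2, by omega⟩
    have : (i : k) ≠ s := Nat.cast_injective.ne (by omega)
    intro h3; apply this; rw [← sub_eq_zero, ← h3]; push_cast; ring

end basic

section abstr
variable {k : Type*} [Field k] [CharZero k] {V : Type*} [AddCommGroup V] [Module k V]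
  {X Y H : V →ₗ[k] V}

lemma H_pow (hHX : ∀ v, H (X v) = X (H v) + X v) {μ : k} {v : V} (hv : H v = μ • v) (j : ℕ) :
    H ((X^j) v) = (μ + j) • (X^j) v := by
  induction j with
  | zero => simp [hv]
  | succ j ih =>
    rw [pow_succ', Module.End.mul_apply, hHX, ih, map_smul]
    push_cast; module

lemma Y_pow (hXY : ∀ v, X (Y v) + Y (X v) = H v)
    (hHX : ∀ v, H (X v) = X (H v) + X v) {μ : k} {v : V} (hv : H v = μ • v) (hY : Y v = 0) (j : ℕ) :
    Y ((X^j) v) = cc μ j • (X^(j-1)) v := by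
  induction j with
  | zero => simp [hY, cc_zero]
  | succ j ih =>
    have h1 := hXY ((X^j) v)
    rw [H_pow hHX hv, ih, map_smul] at h1
    rw [pow_succ', Module.End.mul_apply, cc_add, add_tsub_cancel_right]
    rcases j with _ | j
    · simp only [cc_zero, zero_smul, zero_add] at h1
      rw [h1, cc_zero, sub_zero]
    · rw [add_tsub_cancel_right, ← Module.End.mul_apply, ← pow_succ'] at h1
      rw [eq_sub_of_add_eq' h1]; module

lemma exists_pow_zero [FiniteDimensional k V]
    (hHX : ∀ v, H (X v) = X (H v) + X v) {μ : k} {v : V} (hv : H v = μ • v) :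
    ∃ j, (X^j) v = 0 := by
  by_contra! hcon
  have hli : LinearIndependent k (fun j : ℕ => (X^j) v) := by
    apply Module.End.eigenvectors_linearIndependent' H (fun j : ℕ => μ + (j:k))
    · intro i j hij; simpa using hij
    · intro j
      exact ⟨Module.End.mem_eigenspace_iff.2 (H_pow hHX hv j), hcon j⟩
  exact not_finite_iff_infinite.2 (inferInstance : Infinite ℕ) hli.finite

lemma prim_zero [FiniteDimensional k V] (hXY : ∀ v, X (Y v) + Y (X v) = H v)
    (hHX : ∀ v, H (X v) = X (H v) + X v) (m : ℕ) {v : V} (hv : H v = ((m:k)+1) • v)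
    (hY : Y v = 0) : v = 0 := by
  obtain ⟨j, hj⟩ := exists_pow_zero hHX hv
  induction j with
  | zero => simpa using hj
  | succ j ih =>
    apply ih
    have := Y_pow hXY hHX hv hY (j+1)
    rw [hj, map_zero, add_tsub_cancel_right] at this
    exact (smul_eq_zero.1 this.symm).resolve_left (cc_ne_pos m _ (by omega))

lemma string_end [FiniteDimensional k V] (hXY : ∀ v, X (Y v) + Y (X v) = H v)
    (hHX : ∀ v, H (X v) = X (H v) + X v) (s : ℕ) {v : V} (hv : H v = (-(s:k)) • v)
    (hY : Y v = 0) : (X^(2*s+1)) v = 0 := by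
  apply prim_zero hXY hHX s
  · rw [H_pow hHX hv]; congr 1; push_cast; ring
  · rw [Y_pow hXY hHX hv hY]
    have : cc (-(s:k)) (2*s+1) = 0 := by simp [cc, Nat.add_mod]
    rw [this, zero_smul]

/-- The string map. -/
def psi (X : V →ₗ[k] V) (n : ℕ) (v : V) : (Fin (n+1) → k) →ₗ[k] V :=
  Fintype.linearCombination k (fun j : Fin (n+1) => (X^(j:ℕ)) v)

lemma psi_e {n : ℕ} {v : V} (h : (X^(n+1)) v = 0) (j : ℕ) :
    psi X n v (e k n j) = (X^j) v := by
  by_cases hj : j < n+1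
  · simp only [psi, Fintype.linearCombination_apply, e]
    rw [Finset.sum_eq_single (⟨j, hj⟩ : Fin (n+1))]
    · simp
    · intro b _ hb
      rw [if_neg, zero_smul]
      intro h2; exact hb (Fin.ext h2)
    · simp
  · rw [e_zero (by omega), map_zero, show j = (j-(n+1)) + (n+1) by omega, pow_add,
      Module.End.mul_apply, h, map_zero]

theorem abstract_iso [FiniteDimensional k V] {S : V →ₗ[k] V}
    (hXY : ∀ v, X (Y v) + Y (X v) = H v)
    (hHX : ∀ v, H (X v) = X (H v) + X v) (hS : ∀ v, S (X v) = - X (S v))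
    {N : ℕ} (s ε : Fin N → ℕ) (hs : Function.Injective s) (v : Fin N → V)
    (hv0 : ∀ i, v i ≠ 0) (hvH : ∀ i, H (v i) = (-(s i : k)) • v i) (hvY : ∀ i, Y (v i) = 0)
    (hvS : ∀ i, S (v i) = ((-1:k)^(ε i)) • v i)
    (hdim : ∑ i, (2 * s i + 1) = Module.finrank k V)
    (V0 V1 : Submodule k V) (h0 : ∀ w ∈ V0, S w = w) (h1 : ∀ w ∈ V1, S w = -w) :
    PairIso k V0 V1 X (multiPart k (fun i => 2 * s i) ε 0) (multiPart k (fun i => 2 * s i) ε 1)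
      (multiShift k (fun i => 2 * s i)) := by
  have hend : ∀ i, (X^(2*s i+1)) (v i) = 0 := fun i => string_end hXY hHX (s i) (hvH i) (hvY i)
  let P : (i : Fin N) → (Fin (2 * s i+1) → k) →ₗ[k] V := fun i => psi X (2 * s i) (v i)
  have hPX : ∀ i f, P i (shiftMap k (2*s i) f) = X (P i f) := by
    intro i f
    have : P i ∘ₗ shiftMap k (2*s i) = X ∘ₗ P i := by
      apply e_ext
      intro j _
      simp only [LinearMap.comp_apply, shift_e, P, psi_e (hend i)]
      rw [pow_succ', Module.End.mul_apply]
    exact LinearMap.congr_fun this f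
  have hPY : ∀ i f, P i (yMap k (s i) f) = Y (P i f) := by
    intro i f
    have : P i ∘ₗ yMap k (s i) = Y ∘ₗ P i := by
      apply e_ext
      intro j _
      simp only [LinearMap.comp_apply, yMap_e, P, map_smul, psi_e (hend i)]
      rw [Y_pow hXY hHX (hvH i) (hvY i)]
    exact LinearMap.congr_fun this f
  have hSp : ∀ i j, S ((X^j) (v i)) = ((-1:k)^(j + ε i)) • (X^j) (v i) := by
    intro i j
    induction j with
    | zero => simp [hvS]
    | succ j ih =>
      rw [pow_succ', Module.End.mul_apply, hS, ih, map_smul, ← neg_smul]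
      congr 1; ring
  have hPS : ∀ i f, P i (dMap k (2*s i) (fun j => (-1:k)^(j + ε i)) f) = S (P i f) := by
    intro i f
    have : P i ∘ₗ dMap k (2*s i) (fun j => (-1:k)^(j + ε i)) = S ∘ₗ P i := by
      apply e_ext
      intro j _
      simp only [LinearMap.comp_apply, dMap_e, P, map_smul, psi_e (hend i), hSp]
    exact LinearMap.congr_fun this f
  let F : ((i : Fin N) → (Fin (2 * s i+1) → k)) →ₗ[k] V := ∑ i, (P i) ∘ₗ LinearMap.proj i
  have hF : ∀ f, F f = ∑ i, P i (f i) := by intro f; simp [F]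
  have hvli : LinearIndependent k v := by
    apply Module.End.eigenvectors_linearIndependent' H (fun i => -(s i : k))
    · intro i j hij; apply hs; simpa using hij
    · intro i
      exact ⟨Module.End.mem_eigenspace_iff.2 (hvH i), hv0 i⟩
  have key : ∀ m : ℕ, ∀ f, (∀ i (j : Fin (2 * s i+1)), m ≤ (j:ℕ) → f i j = 0) → F f = 0 →
      f = 0 := by
    intro m
    induction m with
    | zero => intro f hf _; funext i j; exact hf i j (Nat.zero_le _)
    | succ m ih =>
      intro f hf hFf
      have hg : (fun i => yMap k (s i) (f i)) = 0 := by
        apply ih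
        · intro i j hj
          simp only [yMap, LinearMap.coe_mk, AddHom.coe_mk]
          split_ifs with h
          · rw [hf i ⟨j+1, h⟩ (by simpa using hj), mul_zero]
          · rfl
        · rw [hF] at hFf ⊢
          simp only [hPY]
          rw [← map_sum, hFf, map_zero]
      have hf1 : ∀ i, f i = f i 0 • e k _ 0 := by
        intro i
        funext j
        by_cases hj : (j:ℕ) = 0
        · have : j = 0 := Fin.ext hj
          subst this; simp [e]
        · have h2 := congrFun (congrFun hg i) ⟨(j:ℕ)-1, by omega⟩
          simp only [yMap, LinearMap.coe_mk, AddHom.coe_mk, Pi.zero_apply] at h2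
          have hj2 := j.2
          rw [dif_pos (by omega)] at h2
          have h3 : (j:ℕ) - 1 + 1 = j := by omega
          simp only [h3] at h2
          have h4 := (mul_eq_zero.1 h2).resolve_left (cc_ne_neg _ _ (by omega) (by omega))
          simp [e, hj, h4]
      have hsum : ∑ i, f i 0 • v i = 0 := by
        rw [← hFf, hF]
        apply Finset.sum_congr rfl
        intro i _
        conv_rhs => rw [hf1 i]
        simp only [map_smul, P]
        rw [psi_e (hend i)]; simp
      have := Fintype.linearIndependent_iff.1 hvli (fun i => f i 0) hsum
      funext i
      rw [hf1 i, this i, zero_smul]; rfl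
  have hinj : Function.Injective F := by
    rw [injective_iff_map_eq_zero]
    intro f hf
    refine key (∑ i, (2 * s i + 1)) f ?_ hf
    intro i j hj
    exfalso
    have h2 := j.2
    have := Finset.single_le_sum (f := fun i => 2 * s i + 1) (fun i _ => Nat.zero_le _)
      (Finset.mem_univ i)
    omega
  have hfr : Module.finrank k ((i : Fin N) → (Fin (2 * s i+1) → k)) = Module.finrank k V := by
    rw [← hdim, Module.finrank_pi_fintype]
    simp
  let E := LinearEquiv.ofInjectiveOfFinrankEq F hinj hfr
  have hE : ∀ f, E f = F f := fun f => rfl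
  have hES : ∀ w, (fun i => dMap k (2*s i) (fun j => (-1:k)^(j + ε i)) (E.symm w i))
      = E.symm (S w) := by
    intro w
    rw [LinearEquiv.eq_symm_apply, hE, hF]
    simp only [hPS]
    rw [← map_sum, ← hF, ← hE, LinearEquiv.apply_symm_apply]
  refine ⟨E.symm, ?_, ?_, ?_⟩
  · intro w hw
    have h2 := hES w
    rw [h0 w hw] at h2
    simp only [multiPart, stringPart, Submodule.mem_pi, Set.mem_univ, forall_true_left]
    intro i j
    split_ifs with h
    · trivial
    · have h3 := congrFun (congrFun h2 i) j
      simp only [dMap, LinearMap.coe_mk, AddHom.coe_mk] at h3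
      rw [Odd.neg_one_pow (Nat.odd_iff.2 (by omega))] at h3
      rw [Submodule.mem_bot]
      rw [neg_one_mul] at h3
      exact self_eq_neg.1 h3.symm
  · intro w hw
    have h2 := hES w
    rw [h1 w hw, map_neg] at h2
    simp only [multiPart, stringPart, Submodule.mem_pi, Set.mem_univ, forall_true_left]
    intro i j
    split_ifs with h
    · trivial
    · have h3 := congrFun (congrFun h2 i) j
      simp only [dMap, LinearMap.coe_mk, AddHom.coe_mk, Pi.neg_apply] at h3
      rw [Even.neg_one_pow (Nat.even_iff.2 (by omega)), one_mul] at h3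
      rw [Submodule.mem_bot]
      exact self_eq_neg.1 h3
  · intro w
    rw [LinearEquiv.symm_apply_eq, hE, hF]
    simp only [multiShift, LinearMap.pi_apply, LinearMap.comp_apply, LinearMap.proj_apply, hPX]
    rw [← map_sum, ← hF, ← hE, LinearEquiv.apply_symm_apply]

end abstr

section tens
variable {k : Type*} [Field k] [CharZero k]

lemma t_ext {V : Type*} [AddCommGroup V] [Module k V] {n m : ℕ}
    {f g : ((Fin (n+1) → k) ⊗[k] (Fin (m+1) → k)) →ₗ[k] V}
    (h : ∀ i j, f (e k n i ⊗ₜ e k m j) = g (e k n i ⊗ₜ e k m j)) : f = g := by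
  apply TensorProduct.ext
  apply e_ext
  intro i _
  apply e_ext
  intro j _
  exact h i j

/-- Coefficients of the highest weight vectors. -/
def beta (k : Type*) [Field k] (a b d : ℕ) : ℕ → k
  | 0 => 1
  | i+1 => - ((-1)^i * beta k a b d i * cc (-(b:k)) (d-i) / cc (-(a:k)) (i+1))

/-- Primitive vector in degree `d`. -/
def prim (k : Type*) [Field k] (a b d : ℕ) : (Fin (2*a+1) → k) ⊗[k] (Fin (2*b+1) → k) :=
  ∑ i ∈ Finset.range (d+1), beta k a b d i • (e k (2*a) i ⊗ₜ[k] e k (2*b) (d-i))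

lemma prim_ne (a b d : ℕ) (hb : d ≤ 2*b) : prim k a b d ≠ 0 := by
  intro h
  have h2 := congrArg ((TensorProduct.lid k k).toLinearMap ∘ₗ TensorProduct.map
    (LinearMap.proj (0 : Fin (2*a+1)) : (Fin (2*a+1) → k) →ₗ[k] k)
    (LinearMap.proj (⟨d, by omega⟩ : Fin (2*b+1)) : (Fin (2*b+1) → k) →ₗ[k] k)) h
  simp only [prim, map_sum, map_smul, map_zero, LinearMap.comp_apply, TensorProduct.map_tmul,
    LinearMap.proj_apply, LinearEquiv.coe_coe, TensorProduct.lid_tmul] at h2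
  rw [Finset.sum_range_succ'] at h2
  simp [e, beta] at h2

lemma prim_Y {a b d : ℕ} (ha : d ≤ 2*a)
    {Y : ((Fin (2*a+1) → k) ⊗[k] (Fin (2*b+1) → k)) →ₗ[k]
         ((Fin (2*a+1) → k) ⊗[k] (Fin (2*b+1) → k))}
    (hY : ∀ i j, Y (e k (2*a) i ⊗ₜ e k (2*b) j) = cc (-(a:k)) i • e k (2*a) (i-1) ⊗ₜ e k (2*b) j
      + ((-1)^i * cc (-(b:k)) j) • e k (2*a) i ⊗ₜ e k (2*b) (j-1)) : Y (prim k a b d) = 0 := by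
  simp only [prim, map_sum, map_smul, hY, smul_add, Finset.sum_add_distrib]
  rw [Finset.sum_range_succ', Finset.sum_range_succ (fun x => beta k a b d x • (((-1)^x * _) • _))]
  simp only [cc_zero, tsub_self, mul_zero, zero_smul, smul_zero, add_zero]
  rw [← Finset.sum_add_distrib]
  apply Finset.sum_eq_zero
  intro i hi
  rw [Finset.mem_range] at hi
  have hc := cc_ne_neg (k := k) a (i+1) (by omega) (by omega)
  rw [add_tsub_cancel_right, show d - (i+1) = d - i - 1 by omega, smul_smul, smul_smul, ← add_smul]
  rw [show beta k a b d (i+1) * cc (-(a:k)) (i+1)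
    + beta k a b d i * ((-1)^i * cc (-(b:k)) (d-i)) = 0 by
      rw [beta]; field_simp; ring]
  rw [zero_smul]

lemma prim_diag {a b d : ℕ} {c : k}
    {H : ((Fin (2*a+1) → k) ⊗[k] (Fin (2*b+1) → k)) →ₗ[k]
         ((Fin (2*a+1) → k) ⊗[k] (Fin (2*b+1) → k))}
    (hH : ∀ i j, i + j = d → H (e k (2*a) i ⊗ₜ e k (2*b) j) = c • e k (2*a) i ⊗ₜ e k (2*b) j) :
    H (prim k a b d) = c • prim k a b d := by
  simp only [prim, map_sum, map_smul, Finset.smul_sum]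
  apply Finset.sum_congr rfl
  intro i hi
  rw [Finset.mem_range] at hi
  rw [hH i (d-i) (by omega), smul_comm]

lemma e_mem (n j r : ℕ) (h : j % 2 = r) : e k n j ∈ stringPart k n 0 r := by
  simp only [stringPart, Submodule.mem_pi, Set.mem_univ, forall_true_left]
  intro i
  split_ifs with h2
  · trivial
  · rw [Submodule.mem_bot]; simp only [e]; rw [if_neg]; omega

lemma sig0 {n : ℕ} {f : Fin (n+1) → k} (h : f ∈ stringPart k n 0 0) :
    dMap k n (fun j => (-1)^j) f = f := by
  simp only [stringPart, Submodule.mem_pi, Set.mem_univ, forall_true_left] at h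
  funext j
  have hj := h j
  simp only [dMap, LinearMap.coe_mk, AddHom.coe_mk]
  split_ifs at hj with h2
  · rw [Even.neg_one_pow (Nat.even_iff.2 (by omega)), one_mul]
  · rw [Submodule.mem_bot] at hj; simp [hj]

lemma sig1 {n : ℕ} {f : Fin (n+1) → k} (h : f ∈ stringPart k n 0 1) :
    dMap k n (fun j => (-1)^j) f = -f := by
  simp only [stringPart, Submodule.mem_pi, Set.mem_univ, forall_true_left] at h
  funext j
  have hj := h j
  simp only [dMap, LinearMap.coe_mk, AddHom.coe_mk]
  split_ifs at hj with h2
  · rw [Odd.neg_one_pow (Nat.odd_iff.2 (by omega))]; simp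
  · rw [Submodule.mem_bot] at hj; simp [hj]

lemma sum_dim (D n : ℕ) : ∑ i : Fin n, (2 * (D + i.1) + 1) = n * (2 * D + n) := by
  rw [Fin.sum_univ_eq_sum_range (fun i => 2 * (D + i) + 1)]
  induction n with
  | zero => simp
  | succ n ih => rw [Finset.sum_range_succ, ih]; ring

end tens

end CG

open CG

/-- **Clebsch–Gordan decomposition for `𝔾ₐ^{(1|1)}`, even ⊗ even case**:
`M_{2a} ⊗ M_{2b} ≅ ⊕_{s=|a−b|}^{a+b} Π^{(a+b−s) mod 2} M_{2s}`. -/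
theorem clebsch_gordan_even_even {k : Type*} [Field k] [CharZero k] (a b : ℕ)
    (z : ((Fin (2*a+1) → k) ⊗[k] (Fin (2*b+1) → k)) →ₗ[k]
         ((Fin (2*a+1) → k) ⊗[k] (Fin (2*b+1) → k)))
    (hz : IsSuperTensorMap k (stringPart k (2*a) 0 0) (stringPart k (2*a) 0 1)
      (shiftMap k (2*a)) (shiftMap k (2*b)) z) :
    PairIso k
      (tensorEven k (stringPart k (2*a) 0 0) (stringPart k (2*a) 0 1)
        (stringPart k (2*b) 0 0) (stringPart k (2*b) 0 1))
      (tensorOdd k (stringPart k (2*a) 0 0) (stringPart k (2*a) 0 1)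
        (stringPart k (2*b) 0 0) (stringPart k (2*b) 0 1))
      z
      (multiPart k
        (fun i : Fin (a + b - ((a:ℤ)-(b:ℤ)).natAbs + 1) => 2*(((a:ℤ)-(b:ℤ)).natAbs + i.1))
        (fun i => (a + b - (((a:ℤ)-(b:ℤ)).natAbs + i.1)) % 2) 0)
      (multiPart k
        (fun i : Fin (a + b - ((a:ℤ)-(b:ℤ)).natAbs + 1) => 2*(((a:ℤ)-(b:ℤ)).natAbs + i.1))
        (fun i => (a + b - (((a:ℤ)-(b:ℤ)).natAbs + i.1)) % 2) 1)
      (multiShift k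
        (fun i : Fin (a + b - ((a:ℤ)-(b:ℤ)).natAbs + 1) => 2*(((a:ℤ)-(b:ℤ)).natAbs + i.1))) := by
  have hX : ∀ i j, z (e k (2*a) i ⊗ₜ e k (2*b) j) = e k (2*a) (i+1) ⊗ₜ e k (2*b) j
      + ((-1:k)^i) • e k (2*a) i ⊗ₜ e k (2*b) (j+1) := by
    intro i j
    rcases Nat.mod_two_eq_zero_or_one i with h | h
    · rw [hz.1 _ (e_mem _ _ _ h), shift_e, shift_e, Even.neg_one_pow (Nat.even_iff.2 h), one_smul]
    · rw [hz.2 _ (e_mem _ _ _ h), shift_e, shift_e, Odd.neg_one_pow (Nat.odd_iff.2 h)]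
      module
  let Y := TensorProduct.map (CG.yMap k a) LinearMap.id
    + TensorProduct.map (CG.dMap k (2*a) (fun j => (-1)^j)) (CG.yMap k b)
  let H := TensorProduct.map (CG.dMap k (2*a) (fun j => (j:k) - a)) LinearMap.id
    + TensorProduct.map LinearMap.id (CG.dMap k (2*b) (fun j => (j:k) - b))
  let S := TensorProduct.map (CG.dMap k (2*a) (fun j => (-1)^j))
    (CG.dMap k (2*b) (fun j => (-1)^j))
  have hY : ∀ i j, Y (e k (2*a) i ⊗ₜ e k (2*b) j)
      = cc (-(a:k)) i • e k (2*a) (i-1) ⊗ₜ e k (2*b) j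
      + ((-1)^i * cc (-(b:k)) j) • e k (2*a) i ⊗ₜ e k (2*b) (j-1) := by
    intro i j
    simp only [Y, LinearMap.add_apply, TensorProduct.map_tmul, yMap_e, dMap_e, LinearMap.id_apply,
      TensorProduct.smul_tmul_smul]
    rfl
  have hH : ∀ i j, H (e k (2*a) i ⊗ₜ e k (2*b) j)
      = ((i:k) + j - a - b) • e k (2*a) i ⊗ₜ e k (2*b) j := by
    intro i j
    simp only [H, LinearMap.add_apply, TensorProduct.map_tmul, dMap_e, LinearMap.id_apply,
      TensorProduct.tmul_smul, ← TensorProduct.smul_tmul']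
    module
  have hS : ∀ i j, S (e k (2*a) i ⊗ₜ e k (2*b) j)
      = ((-1:k)^(i+j)) • e k (2*a) i ⊗ₜ e k (2*b) j := by
    intro i j
    simp only [S, TensorProduct.map_tmul, dMap_e, TensorProduct.smul_tmul_smul, pow_add]
  have hXY : ∀ v, z (Y v) + Y (z v) = H v := by
    intro v
    have : z ∘ₗ Y + Y ∘ₗ z = H := by
      apply CG.t_ext
      intro i j
      have hsq : ((-1:k)^i) * (-1)^i = 1 := by rw [← mul_pow]; simp
      simp only [LinearMap.add_apply, LinearMap.comp_apply, hX, hY, hH, map_add, map_smul,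
        add_tsub_cancel_right, CG.cc_add]
      rcases i with _ | i <;> rcases j with _ | j <;>
        simp only [add_tsub_cancel_right, CG.cc_zero, CG.cc_add, pow_succ, zero_smul, mul_zero,
          pow_zero, one_smul, smul_add, smul_smul, Nat.cast_zero, zero_tsub] at hsq ⊢ <;>
        match_scalars <;> push_cast <;> grind
    exact LinearMap.congr_fun this v
  have hHX : ∀ v, H (z v) = z (H v) + z v := by
    intro v
    have : H ∘ₗ z = z ∘ₗ H + z := by
      apply CG.t_ext
      intro i j
      simp only [LinearMap.add_apply, LinearMap.comp_apply, hX, hH, map_add, map_smul]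
      push_cast
      module
    exact LinearMap.congr_fun this v
  have hSX : ∀ v, S (z v) = - z (S v) := by
    intro v
    have : S ∘ₗ z = - (z ∘ₗ S) := by
      apply CG.t_ext
      intro i j
      simp only [LinearMap.neg_apply, LinearMap.comp_apply, hX, hS, map_add, map_smul]
      simp only [pow_add, pow_one]
      module
    exact LinearMap.congr_fun this v
  have hD : ((a:ℤ)-(b:ℤ)).natAbs ≤ a + b := by omega
  apply CG.abstract_iso (S := S) hXY hHX hSX
    (fun i : Fin (a + b - ((a:ℤ)-(b:ℤ)).natAbs + 1) => ((a:ℤ)-(b:ℤ)).natAbs + i.1)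
    (fun i => (a + b - (((a:ℤ)-(b:ℤ)).natAbs + i.1)) % 2)
    (v := fun i => CG.prim k a b (a + b - (((a:ℤ)-(b:ℤ)).natAbs + i.1)))
  · intro i j h
    apply Fin.ext
    simpa using h
  · intro i
    apply CG.prim_ne
    omega
  · intro i
    apply CG.prim_diag
    intro p q hpq
    rw [hH]
    congr 1
    have h1 : p + q + (((a:ℤ)-(b:ℤ)).natAbs + i.1) = a + b := by omega
    have h2 : (p:k) + q + ((((a:ℤ)-(b:ℤ)).natAbs + i.1 : ℕ) : k) = a + b := by exact_mod_cast h1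
    linear_combination h2
  · intro i
    apply CG.prim_Y _ hY
    omega
  · intro i
    apply CG.prim_diag
    intro p q hpq
    rw [hS, hpq, ← neg_one_pow_eq_pow_mod_two]
  · rw [CG.sum_dim]
    simp only [Module.finrank_tensorProduct, Module.finrank_fintype_fun_eq_card, Fintype.card_fin]
    rcases le_total a b with h | h
    · obtain ⟨c, rfl⟩ := Nat.exists_eq_add_of_le h
      have h1 : ((a:ℤ)-((a + c : ℕ):ℤ)).natAbs = c := by omega
      rw [h1, show a + (a + c) - c + 1 = 2*a+1 by omega]
      ring
    · obtain ⟨c, rfl⟩ := Nat.exists_eq_add_of_le h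
      have h1 : (((b + c : ℕ):ℤ)-(b:ℤ)).natAbs = c := by omega
      rw [h1, show b + c + b - c + 1 = 2*b+1 by omega]
      ring
  · intro w hw
    induction hw using Submodule.span_induction with
    | mem x hx =>
      rcases hx with ⟨p, hp, q, hq, rfl⟩ | ⟨p, hp, q, hq, rfl⟩
      · simp only [S, TensorProduct.map_tmul, CG.sig0 hp, CG.sig0 hq]
      · simp only [S, TensorProduct.map_tmul, CG.sig1 hp, CG.sig1 hq, TensorProduct.neg_tmul,
          TensorProduct.tmul_neg, neg_neg]
    | zero => simp
    | add x y _ _ hx hy => rw [map_add, hx, hy]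
    | smul c x _ hx => rw [map_smul, hx]
  · intro w hw
    induction hw using Submodule.span_induction with
    | mem x hx =>
      rcases hx with ⟨p, hp, q, hq, rfl⟩ | ⟨p, hp, q, hq, rfl⟩
      · simp only [S, TensorProduct.map_tmul, CG.sig0 hp, CG.sig1 hq, TensorProduct.tmul_neg]
      · simp only [S, TensorProduct.map_tmul, CG.sig1 hp, CG.sig0 hq, TensorProduct.neg_tmul]
    | zero => simp
    | add x y _ _ hx hy => rw [map_add, hx, hy, neg_add]
    | smul c x _ hx => rw [map_smul, hx, smul_neg]
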